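/- Let K, θ, s, F, N be as in the context. Let c_1, …, c_m be nonzero elements of K with N(c_1), …, N(c_m) pairwise distinct, let V_1, …, V_m be F-linear subspaces of K, set n = Σ_{j=1}^{m} dim_F V_j and let k be an integer with 1 ≤ k ≤ n. Then for every tuple (a_0, …, a_{k−1}) ∈ K^k which is not identically zero, setting f_j = Σ_{i=0}^{k−1} μ_{a_i} ∘ (μ_{c_j} ∘ θ)^i, one has Σ_{j=1}^{m} dim_F f_j(V_j) ≥ n − k + 1. In other words, the linearized Reed-Solomon code obtained by evaluating Ore polynomials of degree < k at the points c_j on the spaces V_j has minimal sum-rank weight at least n − k + 1 (it is MSRD). -/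

import Mathlib

/-- The linear map `∑ i < k, a i • (c • σ) ^ i`, i.e. the value at `c` of the Ore polynomial with
coefficients `a i`. -/
noncomputable def oreEval {F K : Type*} [Field F] [Field K] [Algebra F K] (σ : K →ₐ[F] K)
    (k : ℕ) (a : ℕ → K) (c : K) : Module.End F K :=
  ∑ i ∈ Finset.range k, a i • (c • σ.toLinearMap) ^ i

theorem smul_algHom_pow_apply_mul {F K : Type*} [Field F] [Field K] [Algebra F K]
    (σ : K →ₐ[F] K) (c b x : K) (i : ℕ) :
    ((c • σ.toLinearMap) ^ i : Module.End F K) (b * x) =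
      σ^[i] b * ((c • σ.toLinearMap) ^ i : Module.End F K) x := by
  induction i with
  | zero => simp
  | succ i ih =>
    rw [pow_succ', Module.End.mul_apply, Module.End.mul_apply, ih, Function.iterate_succ_apply']
    simp only [LinearMap.smul_apply, AlgHom.toLinearMap_apply, map_mul, smul_eq_mul]
    ring

/-- Right division of an Ore polynomial by `X - b`. -/
theorem exists_oreEval_eq_comp_add {F K : Type*} [Field F] [Field K] [Algebra F K]
    (σ : K →ₐ[F] K) (b : K) (d : ℕ) (a : ℕ → K) :
    ∃ (q : ℕ → K) (r : K), q d = a (d + 1) ∧ ∀ c x : K,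
      oreEval σ (d + 2) a c x = oreEval σ (d + 1) q c (c * σ x - b * x) + r * x := by
  induction d generalizing a with
  | zero =>
    refine ⟨fun _ => a 1, a 0 + a 1 * b, rfl, fun c x => ?_⟩
    simp [oreEval, Finset.sum_range_succ]
    ring
  | succ d ih =>
    obtain ⟨q, r, -, hq⟩ :=
      ih (Function.update a (d + 1) (a (d + 1) + a (d + 2) * σ^[d + 1] b))
    refine ⟨Function.update q (d + 1) (a (d + 2)), r, by simp, fun c x => ?_⟩
    have hupd : ∀ (f : ℕ → K) (n : ℕ) (v : K),
        oreEval σ n (Function.update f n v) c = oreEval σ n f c := by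
      intro f n v
      refine Finset.sum_congr rfl fun i hi => ?_
      rw [Function.update_of_ne (Finset.mem_range.1 hi).ne]
    have hsucc : ∀ (f : ℕ → K) (n : ℕ), oreEval σ (n + 1) f c =
        oreEval σ n f c + f n • (c • σ.toLinearMap) ^ n :=
      fun f n => Finset.sum_range_succ _ _
    have h := hq c x
    rw [hsucc _ (d + 1), hupd] at h
    rw [hsucc a (d + 1 + 1), hsucc a (d + 1), hsucc _ (d + 1), hupd]
    simp only [LinearMap.add_apply, LinearMap.smul_apply, smul_eq_mul, Function.update_self,
      map_sub _ (c * σ x), smul_algHom_pow_apply_mul σ c b] at h ⊢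
    have hp : ((c • σ.toLinearMap) ^ (d + 1 + 1) : Module.End F K) x =
        ((c • σ.toLinearMap) ^ (d + 1) : Module.End F K) (c * σ x) := by
      rw [pow_succ, Module.End.mul_apply]
      simp
    rw [hp]
    linear_combination h

theorem finrank_le_finrank_map_add_finrank_ker {F U W : Type*} [Field F] [AddCommGroup U]
    [Module F U] [AddCommGroup W] [Module F W] [FiniteDimensional F U] (f : U →ₗ[F] W)
    (V : Submodule F U) :
    Module.finrank F V ≤ Module.finrank F (V.map f) + Module.finrank F (LinearMap.ker f) := by
  rw [← (f.domRestrict V).finrank_range_add_finrank_ker, LinearMap.range_domRestrict]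
  refine Nat.add_le_add_left ?_ _
  rw [← Submodule.finrank_map_subtype_eq V]
  refine Submodule.finrank_mono ?_
  rintro _ ⟨x, hx, rfl⟩
  exact hx

theorem finrank_ker_comp_le {F U V W : Type*} [Field F] [AddCommGroup U] [Module F U]
    [AddCommGroup V] [Module F V] [AddCommGroup W] [Module F W] [FiniteDimensional F U]
    [FiniteDimensional F V] (g : V →ₗ[F] W) (f : U →ₗ[F] V) :
    Module.finrank F (LinearMap.ker (g ∘ₗ f)) ≤
      Module.finrank F (LinearMap.ker g) + Module.finrank F (LinearMap.ker f) := by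
  refine (finrank_le_finrank_map_add_finrank_ker f _).trans
    (Nat.add_le_add_right (Submodule.finrank_mono ?_) _)
  rintro _ ⟨x, hx, rfl⟩
  exact hx

theorem prod_iterate_eq_of_mul_eq {K : Type*} [Field K] (σ : K →+* K) (s : ℕ)
    (hs : ∀ x, σ^[s] x = x) {c c' x y : K} (hx : x ≠ 0) (hy : y ≠ 0)
    (h : c * σ y * x = c' * σ x * y) :
    ∏ i ∈ Finset.range s, σ^[i] c = ∏ i ∈ Finset.range s, σ^[i] c' := by
  have hmul : ∀ u v : K, ∏ i ∈ Finset.range s, σ^[i] (u * v) =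
      (∏ i ∈ Finset.range s, σ^[i] u) * ∏ i ∈ Finset.range s, σ^[i] v := fun u v => by
    simp only [iterate_map_mul, Finset.prod_mul_distrib]
  have hne : ∀ u : K, u ≠ 0 → ∏ i ∈ Finset.range s, σ^[i] u ≠ 0 := fun u hu =>
    Finset.prod_ne_zero_iff.2 fun i _ h0 =>
      hu (σ.injective.iterate i (h0.trans (iterate_map_zero σ i).symm))
  have hσ : ∀ u : K, u ≠ 0 →
      ∏ i ∈ Finset.range s, σ^[i] (σ u) = ∏ i ∈ Finset.range s, σ^[i] u := fun u hu => by
    have h1 := Finset.prod_range_succ (fun i => σ^[i] u) s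
    rw [Finset.prod_range_succ', hs] at h1
    exact mul_right_cancel₀ hu h1
  have h2 := congrArg (fun u => ∏ i ∈ Finset.range s, σ^[i] u) h
  simp only [hmul, hσ x hx, hσ y hy] at h2
  refine mul_right_cancel₀ (mul_ne_zero (hne x hx) (hne y hy)) ?_
  linear_combination h2

/-- A nonzero Ore polynomial of degree `< k` has fewer than `k` independent zeros, counted over
points in distinct norm classes. -/
theorem sum_finrank_ker_oreEval_lt {F K ι : Type*} [Field F] [Field K] [Algebra F K]
    [FiniteDimensional F K] [Fintype ι] (σ : K →ₐ[F] K)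
    (hfix : ∀ x, σ x = x → x ∈ (algebraMap F K).range) (s : ℕ) (hs : ∀ x, σ^[s] x = x)
    (c : ι → K) (hc : ∀ j, c j ≠ 0)
    (hN : ∀ j j', j ≠ j' →
      ∏ i ∈ Finset.range s, σ^[i] (c j) ≠ ∏ i ∈ Finset.range s, σ^[i] (c j'))
    (k : ℕ) (a : ℕ → K) (ha : ∃ i < k, a i ≠ 0) :
    ∑ j, Module.finrank F (LinearMap.ker (oreEval σ k a (c j))) < k := by
  classical
  induction k generalizing a with
  | zero => simp at ha
  | succ k ih =>
    by_cases hk : a k = 0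
    · have h : (oreEval σ (k + 1) a : K → Module.End F K) = oreEval σ k a := funext fun c => by
        simp [oreEval, Finset.sum_range_succ, hk]
      rw [h]
      refine (ih a ?_).trans (Nat.lt_succ_self k)
      obtain ⟨i, hi, hai⟩ := ha
      exact ⟨i, lt_of_le_of_ne (Nat.lt_succ_iff.1 hi) (by rintro rfl; exact hai hk), hai⟩
    by_cases hker : ∀ j, LinearMap.ker (oreEval σ (k + 1) a (c j)) = ⊥
    · rw [Finset.sum_eq_zero fun j _ => by rw [hker, finrank_bot]]
      exact Nat.succ_pos k
    push Not at hker
    obtain ⟨j₀, hj₀⟩ := hker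
    obtain ⟨x, hx, hx0⟩ := Submodule.exists_mem_ne_zero_of_ne_bot hj₀
    rw [LinearMap.mem_ker] at hx
    cases k with
    | zero => simp [oreEval, hk, hx0] at hx
    | succ d =>
      obtain ⟨b, hb⟩ : ∃ b, b * x = c j₀ * σ x :=
        ⟨c j₀ * σ x / x, div_mul_cancel₀ _ hx0⟩
      obtain ⟨q, r, hqd, hq⟩ := exists_oreEval_eq_comp_add σ b d a
      have hr : r = 0 := by
        have h := hq (c j₀) x
        rw [hx, hb, sub_self, map_zero, zero_add] at h
        exact (mul_eq_zero.1 h.symm).resolve_right hx0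
      have hcomp : ∀ j, oreEval σ (d + 2) a (c j) =
          oreEval σ (d + 1) q (c j) ∘ₗ (c j • σ.toLinearMap - LinearMap.mulLeft F b) := by
        intro j
        ext y
        simp [hq, hr]
      have hmem : ∀ j y, y ∈ LinearMap.ker (c j • σ.toLinearMap - LinearMap.mulLeft F b) →
          c j * σ y * x = c j₀ * σ x * y := by
        intro j y hy
        have h : c j * σ y - b * y = 0 := by simpa using hy
        linear_combination x * h + y * hb
      have hle : ∀ j, Module.finrank F
          (LinearMap.ker (c j • σ.toLinearMap - LinearMap.mulLeft F b)) ≤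
            if j = j₀ then 1 else 0 := by
        intro j
        split_ifs with hj
        · subst hj
          refine (Submodule.finrank_mono fun y hy => ?_).trans
            (finrank_span_singleton (K := F) hx0).le
          have hσx : σ x ≠ 0 := (map_ne_zero σ).2 hx0
          obtain ⟨t, ht⟩ := hfix (y / x) <| by
            rw [map_div₀, div_eq_div_iff hσx hx0]
            refine mul_left_cancel₀ (hc j) ?_
            linear_combination hmem j y hy
          refine Submodule.mem_span_singleton.2 ⟨t, ?_⟩
          rw [Algebra.smul_def, ht, div_mul_cancel₀ _ hx0]
        · rw [nonpos_iff_eq_zero, Submodule.finrank_eq_zero, Submodule.eq_bot_iff]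
          intro y hy
          by_contra hy0
          exact hN j j₀ hj (prod_iterate_eq_of_mul_eq (σ : K →+* K) s hs hx0 hy0 (hmem j y hy))
      calc ∑ j, Module.finrank F (LinearMap.ker (oreEval σ (d + 2) a (c j)))
          ≤ ∑ j, (Module.finrank F (LinearMap.ker (oreEval σ (d + 1) q (c j))) +
              if j = j₀ then 1 else 0) := Finset.sum_le_sum fun j _ => by
            rw [hcomp]
            exact (finrank_ker_comp_le _ _).trans (Nat.add_le_add_left (hle j) _)
        _ = ∑ j, Module.finrank F (LinearMap.ker (oreEval σ (d + 1) q (c j))) + 1 := by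
            simp [Finset.sum_add_distrib]
        _ < d + 1 + 1 :=
            Nat.add_lt_add_right (ih q ⟨d, Nat.lt_succ_self d, hqd ▸ hk⟩) 1

/-- Linearized Reed-Solomon codes are MSRD, endomorphic case: evaluating a nonzero Ore
polynomial of degree `< k` at points `c_j` on subspaces `V_j` of total dimension `n`
yields maps whose images have total dimension (sum-rank weight) at least `n - k + 1`. -/
theorem linearized_RS_MSRD_endomorphic
    (K : Type*) [Field K] (θ : K ≃+* K) (s : ℕ) (hs : 2 ≤ s)
    (hord : ∀ x : K, (⇑θ)^[s] x = x)
    (hord' : ∀ i : ℕ, 0 < i → i < s → ∃ x : K, (⇑θ)^[i] x ≠ x)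
    (F : Subfield K) (hF : ∀ x : K, x ∈ F ↔ θ x = x)
    [FiniteDimensional F K]
    (m : ℕ) (c : Fin m → K) (hc : ∀ j, c j ≠ 0)
    (hN : ∀ j j' : Fin m, j ≠ j' →
      (∏ i ∈ Finset.range s, (⇑θ)^[i] (c j)) ≠ (∏ i ∈ Finset.range s, (⇑θ)^[i] (c j')))
    (V : Fin m → Submodule F K)
    (n : ℕ) (hn : n = ∑ j : Fin m, Module.finrank F (V j))
    (k : ℕ) (hk1 : 1 ≤ k) (hkn : k ≤ n) :
    ∀ a : Fin k → K, a ≠ 0 →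
      ∀ W : Fin m → Submodule F K,
        (∀ j, (W j : Set K) =
          (fun x => ∑ i : Fin k, a i * (fun y => c j * θ y)^[(i : ℕ)] x) '' (V j : Set K)) →
        n - k + 1 ≤ ∑ j : Fin m, Module.finrank F (W j) := by
  intro a ha W hW
  let σ : K →ₐ[F] K := { (θ : K →+* K) with commutes' := fun x => (hF x).1 x.2 }
  let a' : ℕ → K := fun i => if h : i < k then a ⟨i, h⟩ else 0
  have ha' : ∃ i < k, a' i ≠ 0 := by
    obtain ⟨i, hi⟩ := Function.ne_iff.1 ha
    exact ⟨i, i.2, by simpa [a'] using hi⟩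
  have hlt := sum_finrank_ker_oreEval_lt σ (fun x hx => ⟨⟨x, (hF x).2 hx⟩, rfl⟩) s hord c hc hN
    k a' ha'
  have hmap : ∀ j, W j = (V j).map (oreEval σ k a' (c j)) := by
    intro j
    refine SetLike.coe_injective ?_
    rw [hW, Submodule.map_coe]
    congr 1
    ext x
    rw [oreEval, LinearMap.sum_apply, Finset.sum_range]
    refine Finset.sum_congr rfl fun i _ => ?_
    rw [LinearMap.smul_apply, Module.End.pow_apply]
    simp only [a', i.2, dif_pos, smul_eq_mul]
    rfl
  have hle : n ≤ ∑ j, Module.finrank F (W j) +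
      ∑ j, Module.finrank F (LinearMap.ker (oreEval σ k a' (c j))) := by
    rw [hn, ← Finset.sum_add_distrib]
    refine Finset.sum_le_sum fun j _ => ?_
    rw [hmap]
    exact finrank_le_finrank_map_add_finrank_ker _ _
  omega
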